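/- Let M be a Heyting module over a Heyting algebra H. The set Sub(M) of Heyting submodules of M, topologized with subbasic closed sets V(m₁,…,mₙ) := {N ∈ Sub(M) | m₁,…,mₙ ∈ N} for finite tuples of elements of M, is a spectral space; equivalently, for every ultrafilter 𝔉 on Sub(M), the set N(𝔉) := {m ∈ M | V(m) ∈ 𝔉} is a Heyting submodule of M, and for every subbasic open D(m₁,…,mₙ) = Sub(M) \ V(m₁,…,mₙ), D(m₁,…,mₙ) ∈ 𝔉 if and only if N(𝔉) ∈ D(m₁,…,mₙ). -/

import Mathlib

universe u

/-- A distributive module over a bounded lattice `L`. -/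
structure DistribModule (L : Type u) [Lattice L] [OrderTop L] [OrderBot L]
    (M : Type u) [SemilatticeSup M] [OrderBot M] where
  smul : L → M → M
  smul_mono_left : ∀ ⦃x y : L⦄ (m : M), x ≤ y → smul x m ≤ smul y m
  smul_mono_right : ∀ (x : L) ⦃m n : M⦄, m ≤ n → smul x m ≤ smul x n
  top_smul : ∀ m : M, smul ⊤ m = m
  bot_smul : ∀ m : M, smul ⊥ m = ⊥
  inf_smul : ∀ (x y : L) (m : M), smul (x ⊓ y) m = smul x (smul y m)
  sup_smul : ∀ (x y : L) (m : M), smul (x ⊔ y) m = smul x m ⊔ smul y m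
  smul_sup : ∀ (x : L) (m n : M), smul x (m ⊔ n) = smul x m ⊔ smul x n

/-- A Heyting module over a Heyting algebra `H`: a distributive module such that each
action map `x ↦ x ∧ m` has a right adjoint `(m → -)_M : M → H`. -/
structure HeytingModule (H : Type u) [HeytingAlgebra H]
    (M : Type u) [SemilatticeSup M] [OrderBot M] extends DistribModule H M where
  mimp : M → M → H
  smul_le_iff : ∀ (x : H) (m n : M), smul x m ≤ n ↔ x ≤ mimp m n

/-- A morphism of (distributive/Heyting) modules: preserves `⊥`, finite joins and the action. -/
def IsHom {L : Type u} [Lattice L] [OrderTop L] [OrderBot L]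
    {M N : Type u} [SemilatticeSup M] [OrderBot M] [SemilatticeSup N] [OrderBot N]
    (DM : DistribModule L M) (DN : DistribModule L N) (f : M → N) : Prop :=
  f ⊥ = ⊥ ∧ (∀ m m' : M, f (m ⊔ m') = f m ⊔ f m') ∧
    ∀ (x : L) (m : M), f (DM.smul x m) = DN.smul x (f m)

open MvPolynomial in
theorem MvPolynomial.eq_zero_of_sq_add_sq_eq_zero {I : Type*} {p q : MvPolynomial I ℤ}
    (h : p ^ 2 + q ^ 2 = 0) : p = 0 := by
  refine MvPolynomial.funext fun x => ?_
  have hx := congrArg (eval x) h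
  simp only [map_add, map_pow, map_zero] at hx ⊢
  exact pow_eq_zero_iff two_ne_zero |>.1 <|
    ((add_eq_zero_iff_of_nonneg (sq_nonneg _) (sq_nonneg _)).1 hx).1

namespace Hochster

/-- The field of rational functions over `ℚ` in variables indexed by `I`. -/
abbrev RatField (I : Type u) : Type u := FractionRing (MvPolynomial I ℤ)

variable {I : Type u}

theorem eq_zero_of_sq_add_sq_eq_zero {a b : RatField I} (h : a ^ 2 + b ^ 2 = 0) : a = 0 := by
  obtain ⟨p, r, hr, rfl⟩ := IsFractionRing.div_surjective (A := MvPolynomial I ℤ) a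
  obtain ⟨q, s, hs, rfl⟩ := IsFractionRing.div_surjective (A := MvPolynomial I ℤ) b
  have hr' : algebraMap _ (RatField I) r ≠ 0 :=
    IsFractionRing.to_map_ne_zero_of_mem_nonZeroDivisors hr
  have hs' : algebraMap _ (RatField I) s ≠ 0 :=
    IsFractionRing.to_map_ne_zero_of_mem_nonZeroDivisors hs
  field_simp at h
  have key : (p * s) ^ 2 + (q * r) ^ 2 = 0 := by
    apply IsFractionRing.injective (MvPolynomial I ℤ) (RatField I)
    simp only [map_add, map_mul, map_pow, map_zero]
    linear_combination h
  have := MvPolynomial.eq_zero_of_sq_add_sq_eq_zero key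
  rcases mul_eq_zero.1 this with rfl | rfl
  · simp
  · simp at hs'

/-- The variable of index `i`, as a rational function. -/
noncomputable def var (i : I) : RatField I := algebraMap (MvPolynomial I ℤ) _ (MvPolynomial.X i)

theorem var_ne_zero (i : I) : var i ≠ 0 := by
  simp [var, MvPolynomial.X_ne_zero]

open Classical in
/-- The weight which is `1` on `S` and `0` elsewhere. -/
noncomputable def wt (S : Set I) (i : I) : ℕ := if i ∈ S then 1 else 0

/-- Multiply each variable with index in `S` by an additional variable `t`. -/
noncomputable def scalePoly (S : Set I) : MvPolynomial I ℤ →+* LaurentSeries (RatField I) :=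
  MvPolynomial.eval₂Hom (Int.castRingHom _) fun i => HahnSeries.single (wt S i : ℤ) (var i)

theorem prod_single {ι R : Type*} [CommRing R] (s : Finset ι) (a : ι → ℕ) (r : ι → R) :
    ∏ i ∈ s, HahnSeries.single (a i : ℤ) (r i) =
      HahnSeries.single ((∑ i ∈ s, a i : ℕ) : ℤ) (∏ i ∈ s, r i) := by
  classical
  induction s using Finset.induction_on with
  | empty => simp
  | insert i s hi ih =>
    rw [Finset.prod_insert hi, ih, HahnSeries.single_mul_single, Finset.sum_insert hi,
      Finset.prod_insert hi, Nat.cast_add]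

theorem scalePoly_monomial (S : Set I) (s : I →₀ ℕ) (c : ℤ) :
    scalePoly S (MvPolynomial.monomial s c) =
      HahnSeries.single (Finsupp.weight (wt S) s : ℤ)
        (algebraMap _ _ (MvPolynomial.monomial s c)) := by
  have hc : Int.castRingHom (LaurentSeries (RatField I)) c =
      HahnSeries.single 0 (c : RatField I) :=
    (map_intCast (HahnSeries.C (Γ := ℤ) (R := RatField I)) c).symm
  rw [scalePoly, MvPolynomial.eval₂Hom_monomial, hc, Finsupp.prod]
  have : ∀ i ∈ s.support, (HahnSeries.single (wt S i : ℤ) (var i)) ^ s i =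
      HahnSeries.single ((s i * wt S i : ℕ) : ℤ) (var i ^ s i) := by
    intro i _
    rw [HahnSeries.single_pow]
    simp
  have hmon : algebraMap _ (RatField I) (MvPolynomial.monomial s c) =
      c * ∏ i ∈ s.support, var i ^ s i := by
    rw [MvPolynomial.monomial_eq, map_mul, Finsupp.prod, map_prod]
    simp only [map_pow, var, eq_intCast, map_intCast]
  rw [Finset.prod_congr rfl this, prod_single, HahnSeries.single_mul_single, hmon,
    Finsupp.weight_apply, zero_add]
  rfl

theorem coeff_scalePoly (S : Set I) (p : MvPolynomial I ℤ) (n : ℕ) :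
    (scalePoly S p).coeff (n : ℤ) =
      algebraMap _ _ (MvPolynomial.weightedHomogeneousComponent (wt S) n p) := by
  classical
  induction p using MvPolynomial.induction_on' with
  | monomial s c =>
    rw [scalePoly_monomial, HahnSeries.coeff_single,
      MvPolynomial.weightedHomogeneousComponent_of_mem
        (n := Finsupp.weight (wt S) s) (MvPolynomial.isWeightedHomogeneous_monomial _ _ _ rfl)]
    simp only [Nat.cast_inj]
    split_ifs <;> simp
  | add p q hp hq => simp [hp, hq]

theorem scalePoly_nonneg (S : Set I) (p : MvPolynomial I ℤ) :
    0 ≤ HahnSeries.addVal ℤ (RatField I) (scalePoly S p) := by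
  induction p using MvPolynomial.induction_on' with
  | monomial s c =>
    rw [scalePoly_monomial, HahnSeries.addVal_apply]
    exact le_trans (by exact_mod_cast Nat.zero_le _) HahnSeries.orderTop_single_le
  | add p q hp hq =>
    rw [map_add]
    exact AddValuation.map_le_add _ hp hq

theorem exists_scalePoly_le {p : MvPolynomial I ℤ} (hp : p ≠ 0) :
    ∃ d : ℕ, ∀ S : Set I,
      HahnSeries.addVal ℤ (RatField I) (scalePoly S p) ≤ ((d : ℤ) : WithTop ℤ) := by
  classical
  obtain ⟨s, hs⟩ := MvPolynomial.ne_zero_iff.1 hp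
  refine ⟨s.degree, fun S => ?_⟩
  have h : (scalePoly S p).coeff ((Finsupp.weight (wt S) s : ℕ) : ℤ) ≠ 0 := by
    rw [coeff_scalePoly]
    simp only [ne_eq, FaithfulSMul.algebraMap_eq_zero_iff]
    refine MvPolynomial.ne_zero_iff.2 ⟨s, ?_⟩
    rwa [MvPolynomial.coeff_weightedHomogeneousComponent, if_pos rfl]
  refine (HahnSeries.addVal_le_of_coeff_ne_zero h).trans ?_
  norm_cast
  rw [Finsupp.weight_apply, Finsupp.degree, Finsupp.sum]
  refine Finset.sum_le_sum fun i _ => ?_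
  unfold wt
  split_ifs <;> simp

theorem scalePoly_injective (S : Set I) : Function.Injective (scalePoly S) := by
  refine (injective_iff_map_eq_zero _).2 fun p hp => ?_
  by_contra h
  obtain ⟨d, hd⟩ := exists_scalePoly_le h
  simpa [hp] using hd S

/-- The extension of `scalePoly S` to rational functions. -/
noncomputable def scale (S : Set I) : RatField I →+* LaurentSeries (RatField I) :=
  IsFractionRing.lift (scalePoly_injective S)

theorem scale_algebraMap (S : Set I) (p : MvPolynomial I ℤ) :
    scale S (algebraMap _ _ p) = scalePoly S p :=
  IsFractionRing.lift_algebraMap _ _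

theorem scale_var (S : Set I) (i : I) :
    scale S (var i) = HahnSeries.single (wt S i : ℤ) (var i) := by
  rw [var, scale_algebraMap, scalePoly, MvPolynomial.coe_eval₂Hom, MvPolynomial.eval₂_X, var]

/-- The order of vanishing along the locus where the variables with index in `S` vanish. -/
noncomputable def ord (S : Set I) : AddValuation (RatField I) (WithTop ℤ) :=
  (HahnSeries.addVal ℤ (RatField I)).comap (scale S)

theorem ord_apply (S : Set I) (a : RatField I) :
    ord S a = HahnSeries.addVal ℤ (RatField I) (scale S a) := rfl

/-- The rational functions which are constant in the variables with index in `S`. -/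
noncomputable def constField (S : Set I) : Subfield (RatField I) :=
  (scale S).eqLocusField HahnSeries.C

theorem mem_constField {S : Set I} {a : RatField I} :
    a ∈ constField S ↔ scale S a = HahnSeries.C a := Iff.rfl

theorem var_mem_constField {S : Set I} {i : I} (hi : i ∉ S) : var i ∈ constField S := by
  rw [mem_constField, scale_var, wt, if_neg hi]
  rfl

theorem ord_eq_zero {S : Set I} {a : RatField I} (ha : a ∈ constField S) (h : a ≠ 0) :
    ord S a = 0 := by
  rw [ord_apply, mem_constField.1 ha, HahnSeries.addVal_apply]
  exact HahnSeries.orderTop_single h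

theorem ord_nonneg {S : Set I} {a : RatField I} (ha : a ∈ constField S) : 0 ≤ ord S a := by
  by_cases h : a = 0
  · simp [h]
  · rw [ord_eq_zero ha h]

theorem ord_var_pos {S : Set I} {i : I} (hi : i ∈ S) : 0 < ord S (var i) := by
  rw [ord_apply, scale_var, HahnSeries.addVal_apply, wt, if_pos hi]
  exact HahnSeries.lt_orderTop_single (by simp)

theorem exists_ord_le {a : RatField I} (ha : a ≠ 0) :
    ∃ d : ℕ, ∀ S : Set I, ord S a ≤ ((d : ℤ) : WithTop ℤ) := by
  obtain ⟨p, q, hq, rfl⟩ := IsFractionRing.div_surjective (A := MvPolynomial I ℤ) a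
  have hq' : algebraMap _ (RatField I) q ≠ 0 :=
    IsFractionRing.to_map_ne_zero_of_mem_nonZeroDivisors hq
  have hp : p ≠ 0 := by rintro rfl; simp at ha
  obtain ⟨d, hd⟩ := exists_scalePoly_le hp
  refine ⟨d, fun S => le_trans ?_ (hd S)⟩
  have h : ord S (algebraMap _ _ p / algebraMap _ _ q) + ord S (algebraMap _ _ q) =
      ord S (algebraMap _ _ p) := by
    rw [← AddValuation.map_mul, div_mul_cancel₀ _ hq']
  rw [ord_apply S (algebraMap _ _ p), scale_algebraMap] at h
  rw [← h, ord_apply S (algebraMap _ _ q), scale_algebraMap]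
  exact le_add_of_nonneg_right (scalePoly_nonneg S q)

variable {X : Type u} (E : X → Set I)

/-- A function on `X` which only depends on finitely many of the conditions `i ∈ E x`. -/
def FinDep {Y : Type*} (φ : X → Y) : Prop :=
  ∃ F : Finset I, ∀ x y, (∀ i ∈ F, i ∈ E x ↔ i ∈ E y) → φ x = φ y

variable {E}

theorem FinDep.const {Y : Type*} (c : Y) : FinDep E fun _ => c :=
  ⟨∅, fun _ _ _ => rfl⟩

theorem FinDep.comp {Y Z : Type*} {φ : X → Y} (g : Y → Z) (h : FinDep E φ) :
    FinDep E fun x => g (φ x) :=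
  h.imp fun _ hF x y hxy => congrArg g (hF x y hxy)

theorem FinDep.comp₂ {Y Y' Z : Type*} {φ : X → Y} {ψ : X → Y'} (g : Y → Y' → Z)
    (h : FinDep E φ) (h' : FinDep E ψ) : FinDep E fun x => g (φ x) (ψ x) := by
  classical
  obtain ⟨F, hF⟩ := h
  obtain ⟨G, hG⟩ := h'
  refine ⟨F ∪ G, fun x y hxy => ?_⟩
  simp only [hF x y fun i hi => hxy i (Finset.mem_union_left _ hi),
    hG x y fun i hi => hxy i (Finset.mem_union_right _ hi)]

theorem FinDep.finite_range {Y : Type*} {φ : X → Y} (h : FinDep E φ) : (Set.range φ).Finite := by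
  obtain ⟨F, hF⟩ := h
  rcases isEmpty_or_nonempty X with _ | ⟨⟨x₀⟩⟩
  · exact Set.finite_range φ
  have : Nonempty Y := ⟨φ x₀⟩
  obtain ⟨g, rfl⟩ := (Function.factorsThrough_iff (f := fun x (i : F) => (i : I) ∈ E x) φ).1
    fun x y hxy => hF x y fun i hi => (congrFun hxy ⟨i, hi⟩).to_iff
  exact (Set.finite_range g).subset (Set.range_comp_subset_range _ g)

theorem FinDep.mem_ultrafilter_iff {p : X → Prop} (h : FinDep E p) {f : Ultrafilter X} {x : X}
    (hx : ∀ i, i ∈ E x ↔ {y | i ∈ E y} ∈ f) : {y | p y} ∈ f ↔ p x := by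
  obtain ⟨F, hF⟩ := h
  have hmem : ∀ i ∈ F, {y | i ∈ E x ↔ i ∈ E y} ∈ f := by
    intro i _
    by_cases hi : i ∈ E x
    · simpa [hi] using (hx i).1 hi
    · simp only [hi, false_iff]
      exact Ultrafilter.compl_mem_iff_notMem.2 (mt (hx i).2 hi)
  have hall : {y | ∀ i ∈ F, (i ∈ E x ↔ i ∈ E y)} ∈ f := by
    have := (Filter.biInter_finset_mem F).2 hmem
    filter_upwards [this] with y hy
    simpa using hy
  constructor
  · intro hp
    obtain ⟨y, hy, hpy⟩ := Filter.nonempty_of_mem (Filter.inter_mem hall hp)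
    rw [hF x y hy]
    exact hpy
  · intro hp
    filter_upwards [hall] with y hy
    rwa [← hF x y hy]

theorem ord_mul_sub_mul_pos {S : Set I} {a a' b b' : RatField I} (ha : 0 < ord S (a - a'))
    (hb : 0 < ord S (b - b')) (ha' : 0 ≤ ord S a') (hb' : 0 ≤ ord S b) :
    0 < ord S (a * b - a' * b') := by
  have h : a * b - a' * b' = (a - a') * b + a' * (b - b') := by ring
  rw [h]
  apply AddValuation.map_lt_add
  · rw [AddValuation.map_mul]; exact ha.trans_le (le_add_of_nonneg_right hb')
  · rw [AddValuation.map_mul]; exact hb.trans_le (le_add_of_nonneg_left ha')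

theorem ord_nonneg_of_sub {S : Set I} {a a' : RatField I} (h : 0 < ord S (a - a'))
    (ha' : a' ∈ constField S) : 0 ≤ ord S a := by
  have : a = (a - a') + a' := by ring
  rw [this]
  exact AddValuation.map_le_add _ h.le (ord_nonneg ha')

theorem ord_eq_zero_of_sub {S : Set I} {a a' : RatField I} (h : 0 < ord S (a - a'))
    (ha' : a' ∈ constField S) (h0 : a' ≠ 0) : ord S a = 0 := by
  rw [← ord_eq_zero ha' h0] at h ⊢
  exact AddValuation.map_eq_of_lt_sub _ h

variable (E) in
/-- The ring of compatible families of rational functions on `X`: the value at `x` does not involve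
the variables vanishing at `x`, and values specialize along inclusions `E x ⊆ E y`. -/
noncomputable def functionRing : Subring (X → RatField I) where
  carrier := {φ | FinDep E φ ∧ (∀ x, φ x ∈ constField (E x)) ∧
    ∀ x y, E x ⊆ E y → 0 < ord (E y) (φ x - φ y)}
  zero_mem' := ⟨.const 0, fun _ => zero_mem _, fun _ _ _ => by simp⟩
  one_mem' := ⟨.const 1, fun _ => one_mem _, fun _ _ _ => by simp⟩
  add_mem' := fun {φ ψ} hφ hψ => ⟨hφ.1.comp₂ (· + ·) hψ.1,
    fun x => add_mem (hφ.2.1 x) (hψ.2.1 x), fun x y h => by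
      simp only [Pi.add_apply, add_sub_add_comm]
      exact AddValuation.map_lt_add _ (hφ.2.2 x y h) (hψ.2.2 x y h)⟩
  neg_mem' := fun {φ} hφ => ⟨hφ.1.comp (- ·), fun x => neg_mem (hφ.2.1 x), fun x y h => by
      simp only [Pi.neg_apply, neg_sub_neg]
      rw [AddValuation.map_sub_swap]
      exact hφ.2.2 x y h⟩
  mul_mem' := fun {φ ψ} hφ hψ => ⟨hφ.1.comp₂ (· * ·) hψ.1,
    fun x => mul_mem (hφ.2.1 x) (hψ.2.1 x), fun x y h =>
      ord_mul_sub_mul_pos (hφ.2.2 x y h) (hψ.2.2 x y h) (ord_nonneg (hφ.2.1 y))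
        (ord_nonneg_of_sub (hψ.2.2 x y h) (hψ.2.1 y))⟩

theorem mem_functionRing {φ : X → RatField I} : φ ∈ functionRing E ↔
    FinDep E φ ∧ (∀ x, φ x ∈ constField (E x)) ∧
      ∀ x y, E x ⊆ E y → 0 < ord (E y) (φ x - φ y) := Iff.rfl

open Classical in
/-- The function with value the variable of index `i` wherever `i` does not belong to `E x`. -/
noncomputable def coord (i : I) : functionRing E :=
  ⟨fun x => if i ∈ E x then 0 else var i, ⟨{i}, fun x y h => by simp [h i (by simp)]⟩,
    fun x => by
      dsimp only
      split_ifs with h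
      · exact zero_mem _
      · exact var_mem_constField h,
    fun x y h => by
      by_cases hy : i ∈ E y
      · by_cases hx : i ∈ E x
        · simp [hx, hy]
        · simpa [hx, hy] using ord_var_pos hy
      · simp [hy, mt (@h i) hy]⟩

theorem coord_apply_eq_zero_iff {i : I} {x : X} : (coord i : functionRing E).1 x = 0 ↔ i ∈ E x := by
  simp [coord, var_ne_zero]

theorem ne_zero_of_subset (φ : functionRing E) {x y : X} (h : E x ⊆ E y) (hy : φ.1 y ≠ 0) :
    φ.1 x ≠ 0 := by
  intro hx
  have := ord_eq_zero_of_sub (φ.2.2.2 x y h) (φ.2.2.1 y) hy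
  simp [hx] at this

theorem exists_ord_le_of_finDep {φ : X → RatField I} (h : FinDep E φ) :
    ∃ d : ℕ, ∀ x, φ x ≠ 0 → ∀ S : Set I, ord S (φ x) ≤ ((d : ℤ) : WithTop ℤ) := by
  have key : ∀ c : RatField I, ∃ d : ℕ, c ≠ 0 → ∀ S : Set I, ord S c ≤ ((d : ℤ) : WithTop ℤ) := by
    intro c
    by_cases hc : c = 0
    · exact ⟨0, fun h => absurd hc h⟩
    · exact (exists_ord_le hc).imp fun d hd _ => hd
  choose d hd using key
  refine ⟨h.finite_range.toFinset.sup d, fun x hx S => (hd _ hx S).trans ?_⟩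
  have : d (φ x) ≤ h.finite_range.toFinset.sup d := Finset.le_sup (by simp)
  exact_mod_cast this

/-- If `φ` vanishes wherever `b` does, then a power of `φ` is divisible by `b`. -/
theorem exists_pow_eq_mul (φ b : functionRing E) (h : ∀ x, b.1 x = 0 → φ.1 x = 0) :
    ∃ (n : ℕ) (c : functionRing E), φ ^ n = b * c := by
  obtain ⟨d, hd⟩ := exists_ord_le_of_finDep b.2.1
  have hmem : (fun x => φ.1 x ^ (d + 1) / b.1 x) ∈ functionRing E := by
    refine ⟨φ.2.1.comp₂ (fun u v => u ^ (d + 1) / v) b.2.1,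
      fun x => div_mem (pow_mem (φ.2.2.1 x) _) (b.2.2.1 x), fun x y hxy => ?_⟩
    have hpow := (φ ^ (d + 1)).2.2.2 x y hxy
    have hpowy := (φ ^ (d + 1)).2.2.1 y
    simp only [SubmonoidClass.coe_pow, Pi.pow_apply] at hpow hpowy
    by_cases hby : b.1 y = 0
    · simp only [hby, div_zero, sub_zero]
      by_cases hbx : b.1 x = 0
      · simp [hbx]
      have h1 : (1 : WithTop ℤ) ≤ ord (E y) (φ.1 x) := by
        have := φ.2.2.2 x y hxy
        rw [h y hby, sub_zero] at this
        revert this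
        induction ord (E y) (φ.1 x) using WithTop.recTopCoe with
        | top => simp
        | coe n => exact fun hn => by exact_mod_cast hn
      have h2 : ((d : ℤ) : WithTop ℤ) < ord (E y) (φ.1 x ^ (d + 1)) := by
        rw [AddValuation.map_pow]
        refine lt_of_lt_of_le ?_ (nsmul_le_nsmul_right h1 (d + 1))
        rw [nsmul_one]
        exact_mod_cast Nat.lt_succ_self d
      rw [← div_mul_cancel₀ (φ.1 x ^ (d + 1)) hbx, AddValuation.map_mul] at h2
      by_contra hneg
      have := add_le_add (not_lt.1 hneg) (hd x hbx (E y))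
      rw [zero_add] at this
      exact absurd h2 this.not_gt
    · have hbx := ne_zero_of_subset b hxy hby
      have hvx := ord_eq_zero_of_sub (b.2.2.2 x y hxy) (b.2.2.1 y) hby
      have hvy := ord_eq_zero (b.2.2.1 y) hby
      have hsub : 0 < ord (E y) (φ.1 x ^ (d + 1) * b.1 y - φ.1 y ^ (d + 1) * b.1 x) := by
        refine ord_mul_sub_mul_pos hpow ?_ (ord_nonneg hpowy) hvy.ge
        rw [AddValuation.map_sub_swap]
        exact b.2.2.2 x y hxy
      have heq : φ.1 x ^ (d + 1) * b.1 y - φ.1 y ^ (d + 1) * b.1 x =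
          (φ.1 x ^ (d + 1) / b.1 x - φ.1 y ^ (d + 1) / b.1 y) * (b.1 x * b.1 y) := by
        field_simp
      rw [heq, AddValuation.map_mul, AddValuation.map_mul, hvx, hvy] at hsub
      simpa using hsub
  refine ⟨d + 1, ⟨_, hmem⟩, Subtype.ext <| funext fun x => ?_⟩
  by_cases hb : b.1 x = 0
  · simp [hb, h x hb]
  · simp [mul_div_cancel₀ _ hb]

variable (E) in
/-- The prime ideal of functions vanishing at a point. -/
noncomputable def toPrimeSpectrum (x : X) : PrimeSpectrum (functionRing E) :=
  PrimeSpectrum.comap ((Pi.evalRingHom _ x).comp (functionRing E).subtype) ⊥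

theorem mem_toPrimeSpectrum {x : X} {φ : functionRing E} :
    φ ∈ (toPrimeSpectrum E x).asIdeal ↔ φ.1 x = 0 := Iff.rfl

theorem toPrimeSpectrum_injective (hE : Function.Injective E) :
    Function.Injective (toPrimeSpectrum E) := by
  refine fun x y h => hE (Set.ext fun i => ?_)
  rw [← coord_apply_eq_zero_iff, ← mem_toPrimeSpectrum, h, mem_toPrimeSpectrum,
    coord_apply_eq_zero_iff]

/-- Every ultrafilter on `X` has a limit for the constructible topology. -/
def UltraClosed (E : X → Set I) : Prop :=
  ∀ f : Ultrafilter X, ∃ x, ∀ i, i ∈ E x ↔ {y | i ∈ E y} ∈ f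

theorem toPrimeSpectrum_surjective (hU : UltraClosed E) :
    Function.Surjective (toPrimeSpectrum E) := by
  intro P
  let s : functionRing E × functionRing E → Set X := fun q => {x | q.1.1 x = 0 ∧ q.2.1 x ≠ 0}
  have hbasis : Filter.IsBasis
      (fun q : functionRing E × functionRing E => q.1 ∈ P.asIdeal ∧ q.2 ∉ P.asIdeal) s := by
    refine ⟨⟨(0, 1), zero_mem _, (Ideal.ne_top_iff_one _).1 P.isPrime.ne_top⟩, ?_⟩
    rintro ⟨a, b⟩ ⟨a', b'⟩ ⟨ha, hb⟩ ⟨ha', hb'⟩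
    refine ⟨(a ^ 2 + a' ^ 2, b * b'), ⟨add_mem (Ideal.pow_mem_of_mem _ ha 2 two_pos)
      (Ideal.pow_mem_of_mem _ ha' 2 two_pos), fun h => (P.isPrime.mem_or_mem h).elim hb hb'⟩, ?_⟩
    rintro x ⟨h1, h2⟩
    have h1' : a.1 x ^ 2 + a'.1 x ^ 2 = 0 := h1
    have h2' : b.1 x * b'.1 x ≠ 0 := h2
    exact ⟨⟨eq_zero_of_sq_add_sq_eq_zero h1', left_ne_zero_of_mul h2'⟩,
      eq_zero_of_sq_add_sq_eq_zero ((add_comm _ _).trans h1'), right_ne_zero_of_mul h2'⟩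
  have hne : hbasis.filter.NeBot := by
    refine hbasis.hasBasis.neBot_iff.2 ?_
    rintro ⟨a, b⟩ ⟨ha, hb⟩
    by_contra hempty
    rw [Set.not_nonempty_iff_eq_empty] at hempty
    obtain ⟨n, c, hc⟩ := exists_pow_eq_mul b a fun x hx => by
      by_contra hbx
      exact (Set.eq_empty_iff_forall_notMem.1 hempty x) ⟨hx, hbx⟩
    exact hb (P.isPrime.mem_of_pow_mem n (hc ▸ P.asIdeal.mul_mem_right c ha))
  let f : Ultrafilter X := Ultrafilter.of hbasis.filter
  have hf : ∀ q : functionRing E × functionRing E,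
      q.1 ∈ P.asIdeal ∧ q.2 ∉ P.asIdeal → s q ∈ f := fun q hq =>
    Ultrafilter.of_le _ (hbasis.mem_filter_iff.2 ⟨q, hq, subset_rfl⟩)
  obtain ⟨x, hx⟩ := hU f
  refine ⟨x, PrimeSpectrum.ext (Ideal.ext fun φ => ?_)⟩
  rw [mem_toPrimeSpectrum, ← (φ.2.1.comp (· = 0)).mem_ultrafilter_iff hx]
  constructor
  · intro h
    by_contra hφ
    obtain ⟨y, hy, hy'⟩ := Filter.nonempty_of_mem
      (Filter.inter_mem h (hf (0, φ) ⟨zero_mem _, hφ⟩))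
    exact hy'.2 hy
  · intro h
    filter_upwards [hf (φ, 1) ⟨h, (Ideal.ne_top_iff_one _).1 P.isPrime.ne_top⟩] with y hy
    exact hy.1

variable [TopologicalSpace X]

theorem isOpen_ne_zero (hU : UltraClosed E) (hD : ∀ i, IsOpen {x | i ∉ E x})
    (φ : functionRing E) : IsOpen {x | φ.1 x ≠ 0} := by
  refine isOpen_iff_forall_mem_open.2 fun x hx => ?_
  by_contra hcon
  push Not at hcon
  let s : Finset I → Set X := fun F => {y | (∀ i ∈ F, i ∉ E x → i ∉ E y) ∧ φ.1 y = 0}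
  have hbasis : Filter.IsBasis (fun _ : Finset I => True) s := by
    classical
    refine ⟨⟨∅, trivial⟩, fun {F G} _ _ => ⟨F ∪ G, trivial, fun y hy => ⟨⟨fun i hi => ?_, hy.2⟩,
      ⟨fun i hi => ?_, hy.2⟩⟩⟩⟩
    · exact hy.1 i (Finset.mem_union_left _ hi)
    · exact hy.1 i (Finset.mem_union_right _ hi)
  have hne : hbasis.filter.NeBot := by
    refine hbasis.hasBasis.neBot_iff.2 fun {F} _ => ?_
    by_contra hempty
    rw [Set.not_nonempty_iff_eq_empty] at hempty
    refine hcon (⋂ i ∈ F, {y | i ∉ E x → i ∉ E y}) (fun y hy hy0 => ?_) ?_ ?_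
    · exact Set.eq_empty_iff_forall_notMem.1 hempty y ⟨by simpa using hy, hy0⟩
    · refine isOpen_biInter_finset fun i _ => ?_
      by_cases hi : i ∈ E x
      · simp [hi]
      · simpa [hi] using hD i
    · simp
  let f : Ultrafilter X := Ultrafilter.of hbasis.filter
  have hf : ∀ F : Finset I, s F ∈ f := fun F =>
    Ultrafilter.of_le _ (hbasis.mem_filter_iff.2 ⟨F, trivial, subset_rfl⟩)
  obtain ⟨y, hy⟩ := hU f
  have hy0 : φ.1 y = 0 := by
    rw [← (φ.2.1.comp (· = 0)).mem_ultrafilter_iff hy]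
    exact Filter.mem_of_superset (hf ∅) fun z hz => hz.2
  refine ne_zero_of_subset φ (fun i hi => ?_) hx hy0
  by_contra hix
  obtain ⟨z, hz, hz'⟩ := Filter.nonempty_of_mem (Filter.inter_mem (hf {i}) ((hy i).1 hi))
  exact hz.1 i (by simp) hix hz'

/-- A space which is patch-closed in a power of the Sierpiński space is the prime spectrum of
a commutative ring. -/
theorem exists_homeomorph_primeSpectrum (hE : Function.Injective E) (hU : UltraClosed E)
    (hX : ‹TopologicalSpace X› = TopologicalSpace.generateFrom {U | ∃ i, U = {x | i ∉ E x}}) :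
    ∃ (R : Type u) (_ : CommRing R), Nonempty (X ≃ₜ PrimeSpectrum R) := by
  have hD : ∀ i, IsOpen {x | i ∉ E x} := fun i => by
    rw [hX]
    exact TopologicalSpace.isOpen_generateFrom_of_mem ⟨i, rfl⟩
  have hpre : ∀ φ : functionRing E,
      toPrimeSpectrum E ⁻¹' (PrimeSpectrum.basicOpen φ) = {x | φ.1 x ≠ 0} := fun φ => rfl
  have hind : Topology.IsInducing (toPrimeSpectrum E) := by
    refine ⟨le_antisymm (Continuous.le_induced ?_) ?_⟩
    · refine PrimeSpectrum.isTopologicalBasis_basic_opens.continuous_iff.2 ?_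
      rintro _ ⟨φ, rfl⟩
      rw [hpre]
      exact isOpen_ne_zero hU hD φ
    · conv_rhs => rw [hX]
      refine le_generateFrom ?_
      rintro _ ⟨i, rfl⟩
      refine isOpen_induced_iff.2 ⟨_, (PrimeSpectrum.basicOpen (coord i)).isOpen, ?_⟩
      rw [hpre]
      simp [coord_apply_eq_zero_iff]
  exact ⟨functionRing E, inferInstance, ⟨(Equiv.ofBijective _ ⟨toPrimeSpectrum_injective hE,
    toPrimeSpectrum_surjective hU⟩).toHomeomorphOfIsInducing hind⟩⟩

end Hochster

/-- The set of Heyting submodules of a Heyting module `M`, with the topology whose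
subbasic closed sets are the `V(m₁,…,mₙ)`, is a spectral space (homeomorphic to the
Zariski spectrum of a commutative ring); equivalently, for every ultrafilter `𝔉` the
set `N(𝔉) = {m | V(m) ∈ 𝔉}` is a Heyting submodule and `D(m₁,…,mₙ) ∈ 𝔉` iff
`N(𝔉) ∈ D(m₁,…,mₙ)`. -/
theorem submodules_spectralSpace (H : Type u) [HeytingAlgebra H]
    (M : Type u) [SemilatticeSup M] [OrderBot M] (HM : HeytingModule H M) :
    let Sub := {S : Set M // ⊥ ∈ S ∧ (∀ a b : M, a ∈ S → b ∈ S → a ⊔ b ∈ S) ∧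
      ∀ (c : H) (a : M), a ∈ S → HM.smul c a ∈ S}
    let V : Finset M → Set Sub := fun F => {N : Sub | ∀ m ∈ F, m ∈ N.1}
    letI : TopologicalSpace Sub :=
      TopologicalSpace.generateFrom {U : Set Sub | ∃ F : Finset M, U = (V F)ᶜ}
    (∃ (R : Type u) (_ : CommRing R), Nonempty (Sub ≃ₜ PrimeSpectrum R)) ∧
    ∀ 𝔉 : Ultrafilter Sub,
      let NF : Set M := {m : M | {N : Sub | m ∈ N.1} ∈ 𝔉}
      (⊥ ∈ NF ∧ (∀ a b : M, a ∈ NF → b ∈ NF → a ⊔ b ∈ NF) ∧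
        ∀ (c : H) (a : M), a ∈ NF → HM.smul c a ∈ NF) ∧
      ∀ F : Finset M, (V F)ᶜ ∈ 𝔉 ↔ ¬ ∀ m ∈ F, m ∈ NF := by
  intro Sub V
  have hlim : ∀ 𝔉 : Ultrafilter Sub,
      ⊥ ∈ {m : M | {N : Sub | m ∈ N.1} ∈ 𝔉} ∧
      (∀ a b : M, a ∈ {m : M | {N : Sub | m ∈ N.1} ∈ 𝔉} →
        b ∈ {m : M | {N : Sub | m ∈ N.1} ∈ 𝔉} → a ⊔ b ∈ {m : M | {N : Sub | m ∈ N.1} ∈ 𝔉}) ∧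
      ∀ (c : H) (a : M), a ∈ {m : M | {N : Sub | m ∈ N.1} ∈ 𝔉} →
        HM.smul c a ∈ {m : M | {N : Sub | m ∈ N.1} ∈ 𝔉} := fun 𝔉 =>
    ⟨Filter.mem_of_superset Filter.univ_mem fun N _ => N.2.1,
      fun a b ha hb => Filter.mem_of_superset (Filter.inter_mem ha hb)
        fun N hN => N.2.2.1 a b hN.1 hN.2,
      fun c a ha => Filter.mem_of_superset ha fun N hN => N.2.2.2 c a hN⟩
  have hV : ∀ F : Finset M, V F = ⋂ m ∈ F, {N : Sub | m ∈ N.1} := fun F => by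
    ext N
    simp [V]
  refine ⟨?_, fun 𝔉 => ⟨hlim 𝔉, fun F => ?_⟩⟩
  · let : TopologicalSpace Sub :=
      TopologicalSpace.generateFrom {U : Set Sub | ∃ F : Finset M, U = (V F)ᶜ}
    refine Hochster.exists_homeomorph_primeSpectrum (E := fun N : Sub => N.1)
      Subtype.val_injective (fun 𝔉 => ⟨⟨_, hlim 𝔉⟩, fun m => Iff.rfl⟩) (le_antisymm ?_ ?_)
    · refine le_generateFrom ?_
      rintro _ ⟨m, rfl⟩
      refine TopologicalSpace.isOpen_generateFrom_of_mem ⟨{m}, ?_⟩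
      ext N
      simp [V]
    · refine le_generateFrom ?_
      rintro _ ⟨F, rfl⟩
      rw [hV, Set.compl_iInter₂]
      let : TopologicalSpace Sub :=
        TopologicalSpace.generateFrom {U | ∃ m : M, U = {N : Sub | m ∉ N.1}}
      exact isOpen_biUnion fun m _ => TopologicalSpace.isOpen_generateFrom_of_mem ⟨m, rfl⟩
  · rw [Ultrafilter.compl_mem_iff_notMem, hV]
    exact not_congr (Filter.biInter_finset_mem F)
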